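/- arXiv:1601.03791 — 4 statements merged into one kernel-verified Lean document; each statement's English description precedes it below -/
import Mathlib

section
/- Let Y₁ be the graph obtained from the complete graph K₈ by twice subdividing one edge wz, i.e., replacing the edge wz by a path w–x–y–z through two new vertices x, y. Then |Y₁| = 10, σ₂(Y₁) = 9, α(Y₁) = 2, and Y₁ does not contain 3 pairwise vertex-disjoint cycles. -/
/-- `G` contains `n` pairwise vertex-disjoint cycles. -/
def SimpleGraph.HasNDisjointCycles {V : Type*} (G : SimpleGraph V) (n : ℕ) : Prop :=
  ∃ f : Fin n → Σ v : V, G.Walk v v,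
    (∀ i, (f i).2.IsCycle) ∧
    ∀ i j, i ≠ j → ∀ v, v ∈ (f i).2.support → v ∉ (f j).2.support

/-- The independence number of `G`: the largest size of an independent set of vertices. -/
noncomputable def SimpleGraph.independenceNum {V : Type*} (G : SimpleGraph V) : ℕ :=
  sSup {n | ∃ s : Finset V, s.card = n ∧ ∀ v ∈ s, ∀ w ∈ s, v ≠ w → ¬ G.Adj v w}

/-- The minimum Ore degree `σ₂(G)`: the minimum of `d(x) + d(y)` over distinct nonadjacent
vertices `x, y`, with value `∞` if `G` is complete. -/
noncomputable def SimpleGraph.sigma2 {V : Type*} [Fintype V] (G : SimpleGraph V)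
    [DecidableRel G.Adj] : ℕ∞ :=
  ⨅ (x : V) (y : V) (_ : x ≠ y) (_ : ¬ G.Adj x y), ((G.degree x + G.degree y : ℕ) : ℕ∞)

/-- The graph `Y₁`: the complete graph `K₈` (on vertices `0, …, 7`) with the edge between
`0` and `1` replaced by the path `0 – 8 – 9 – 1` through the two new vertices `8` and `9`. -/
def Y1 : SimpleGraph (Fin 10) :=
  SimpleGraph.fromRel (fun a b =>
    (a.val < 8 ∧ b.val < 8 ∧ ¬(a.val = 0 ∧ b.val = 1) ∧ ¬(a.val = 1 ∧ b.val = 0)) ∨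
    (a.val = 0 ∧ b.val = 8) ∨ (a.val = 8 ∧ b.val = 9) ∨ (a.val = 9 ∧ b.val = 1))

instance : DecidableRel Y1.Adj := fun a b =>
  decidable_of_iff' _ (SimpleGraph.fromRel_adj _ a b)

theorem Y1_cycle_nbrs {v : Fin 10} (p : Y1.Walk v v) (hp : p.IsCycle) :
    ∀ x ∈ p.support.toFinset, ∃ u ∈ p.support.toFinset, ∃ w ∈ p.support.toFinset,
      u ≠ w ∧ Y1.Adj x u ∧ Y1.Adj x w := by
  intro x hx
  have h2 := hp.ncard_neighborSet_toSubgraph_eq_two (List.mem_toFinset.1 hx)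
  obtain ⟨u, w, huw, hs⟩ := Set.ncard_eq_two.1 h2
  have hu : p.toSubgraph.Adj x u := by
    have : u ∈ p.toSubgraph.neighborSet x := by rw [hs]; simp
    exact this
  have hw : p.toSubgraph.Adj x w := by
    have : w ∈ p.toSubgraph.neighborSet x := by rw [hs]; simp
    exact this
  refine ⟨u, ?_, w, ?_, huw, hu.adj_sub, hw.adj_sub⟩
  · rw [List.mem_toFinset, ← SimpleGraph.Walk.mem_verts_toSubgraph]
    exact hu.snd_mem
  · rw [List.mem_toFinset, ← SimpleGraph.Walk.mem_verts_toSubgraph]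
    exact hw.snd_mem

theorem Y1_adj8 : ∀ u, Y1.Adj 8 u → u = 0 ∨ u = 9 := by decide
theorem Y1_adj9 : ∀ u, Y1.Adj 9 u → u = 1 ∨ u = 8 := by decide
theorem Y1_adj0 : ∀ u, Y1.Adj 0 u → u = 8 ∨ (u ≠ 0 ∧ u ≠ 1 ∧ u ≠ 8 ∧ u ≠ 9) := by decide

theorem Y1_three_le (S : Finset (Fin 10)) (hne : S.Nonempty)
    (h : ∀ x ∈ S, ∃ u ∈ S, ∃ w ∈ S, u ≠ w ∧ Y1.Adj x u ∧ Y1.Adj x w) : 3 ≤ S.card := by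
  obtain ⟨x, hx⟩ := hne
  obtain ⟨u, hu, w, hw, huw, h1, h2⟩ := h x hx
  have : ({x, u, w} : Finset (Fin 10)) ⊆ S := by
    intro y hy
    simp only [Finset.mem_insert, Finset.mem_singleton] at hy
    rcases hy with rfl | rfl | rfl <;> assumption
  calc 3 = ({x, u, w} : Finset (Fin 10)).card := by
        rw [Finset.card_eq_three.2 ⟨x, u, w, h1.ne, h2.ne, huw, rfl⟩]
    _ ≤ _ := Finset.card_le_card this

theorem Y1_five_le (S : Finset (Fin 10))
    (h : ∀ x ∈ S, ∃ u ∈ S, ∃ w ∈ S, u ≠ w ∧ Y1.Adj x u ∧ Y1.Adj x w)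
    (h89 : 8 ∈ S ∨ 9 ∈ S) : 5 ≤ S.card := by
  have k8 : 8 ∈ S → 0 ∈ S ∧ 9 ∈ S := by
    intro h8
    obtain ⟨u, hu, w, hw, huw, h1, h2⟩ := h 8 h8
    rcases Y1_adj8 u h1 with rfl | rfl <;> rcases Y1_adj8 w h2 with rfl | rfl <;> simp_all
  have k9 : 9 ∈ S → 1 ∈ S ∧ 8 ∈ S := by
    intro h9
    obtain ⟨u, hu, w, hw, huw, h1, h2⟩ := h 9 h9
    rcases Y1_adj9 u h1 with rfl | rfl <;> rcases Y1_adj9 w h2 with rfl | rfl <;> simp_all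
  have h8 : 8 ∈ S := h89.elim id (fun t => (k9 t).2)
  have h9 := (k8 h8).2
  have h0 := (k8 h8).1
  have h1 := (k9 h9).1
  have : ∃ t ∈ S, t ≠ 0 ∧ t ≠ 1 ∧ t ≠ 8 ∧ t ≠ 9 := by
    obtain ⟨u, hu, w, hw, huw, a1, a2⟩ := h 0 h0
    rcases Y1_adj0 u a1 with e | e
    · rcases Y1_adj0 w a2 with e' | e'
      · exact absurd (e.trans e'.symm) huw
      · exact ⟨w, hw, e'⟩
    · exact ⟨u, hu, e⟩
  obtain ⟨t, ht, t0, t1, t8, t9⟩ := this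
  have hsub : insert t ({0, 1, 8, 9} : Finset (Fin 10)) ⊆ S := by
    intro y hy
    simp only [Finset.mem_insert, Finset.mem_singleton] at hy
    rcases hy with rfl | rfl | rfl | rfl | rfl <;> assumption
  calc 5 = (insert t ({0, 1, 8, 9} : Finset (Fin 10))).card := by
        rw [Finset.card_insert_of_notMem (by simp [t0, t1, t8, t9])]; rfl
    _ ≤ _ := Finset.card_le_card hsub

theorem Y1_no_three : ¬ Y1.HasNDisjointCycles 3 := by
  rintro ⟨f, hc, hd⟩
  set S : Fin 3 → Finset (Fin 10) := fun i => (f i).2.support.toFinset with hS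
  have hP : ∀ i, ∀ x ∈ S i, ∃ u ∈ S i, ∃ w ∈ S i, u ≠ w ∧ Y1.Adj x u ∧ Y1.Adj x w :=
    fun i => Y1_cycle_nbrs (f i).2 (hc i)
  have h3 : ∀ i, 3 ≤ (S i).card := fun i =>
    Y1_three_le (S i) ⟨(f i).1, List.mem_toFinset.2 (f i).2.start_mem_support⟩ (hP i)
  have hdis : ∀ i j, i ≠ j → Disjoint (S i) (S j) := by
    intro i j hij
    rw [Finset.disjoint_left]
    intro v hi hj
    exact hd i j hij v (List.mem_toFinset.1 hi) (List.mem_toFinset.1 hj)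
  have hcard : (Finset.univ.biUnion S).card = (S 0).card + (S 1).card + (S 2).card := by
    rw [Finset.card_biUnion (fun i _ j _ hij => hdis i j hij), Fin.sum_univ_three]
  have h0 := h3 0
  have h1 := h3 1
  have h2 := h3 2
  by_cases hex : ∃ i, 8 ∈ S i ∨ 9 ∈ S i
  · obtain ⟨i, hi⟩ := hex
    have h5 := Y1_five_le (S i) (hP i) hi
    have hle : (Finset.univ.biUnion S).card ≤ 10 := Finset.card_le_univ _
    fin_cases i <;> simp only [Fin.zero_eta, Fin.mk_one, Fin.reduceFinMk] at h5 <;> omega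
  · push Not at hex
    have hsub : Finset.univ.biUnion S ⊆ ((Finset.univ.erase 8).erase 9) := by
      intro y hy
      obtain ⟨i, -, hi⟩ := Finset.mem_biUnion.1 hy
      have := hex i
      simp only [Finset.mem_erase, Finset.mem_univ, and_true]
      constructor <;> rintro rfl
      · exact this.2 hi
      · exact this.1 hi
    have := Finset.card_le_card hsub
    have e : ((Finset.univ.erase (8 : Fin 10)).erase 9).card = 8 := by decide
    omega

theorem Y1_sigma2 : Y1.sigma2 = 9 := by
  unfold SimpleGraph.sigma2
  apply le_antisymm
  · refine (iInf₂_le (8 : Fin 10) (2 : Fin 10)).trans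
      ((iInf₂_le (by decide) (by decide)).trans ?_)
    have : Y1.degree 8 + Y1.degree 2 = 9 := by decide
    rw [this]; rfl
  · have key : ∀ x y, x ≠ y → ¬ Y1.Adj x y → 9 ≤ Y1.degree x + Y1.degree y := by decide
    refine le_iInf fun x => le_iInf fun y => le_iInf fun hxy => le_iInf fun hn => ?_
    exact_mod_cast key x y hxy hn

theorem Y1_alpha : Y1.independenceNum = 2 := by
  unfold SimpleGraph.independenceNum
  have key : ∀ a b c, a ≠ b → a ≠ c → b ≠ c → Y1.Adj a b ∨ Y1.Adj a c ∨ Y1.Adj b c := by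
    decide
  apply IsGreatest.csSup_eq
  constructor
  · exact ⟨{8, 2}, by decide, by decide⟩
  · rintro n ⟨s, rfl, hs⟩
    by_contra hlt
    obtain ⟨a, b, c, ha, hb, hc, hab, hac, hbc⟩ := Finset.two_lt_card_iff.1 (not_le.1 hlt)
    rcases key a b c hab hac hbc with h | h | h
    · exact hs a ha b hb hab h
    · exact hs a ha c hc hac h
    · exact hs b hb c hc hbc h

/-- The graph `Y₁` has `10` vertices, `σ₂(Y₁) = 9` and `α(Y₁) = 2`, but it does not contain
`3` pairwise vertex-disjoint cycles. -/
theorem y1_example :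
    Fintype.card (Fin 10) = 10 ∧
    Y1.sigma2 = 9 ∧
    Y1.independenceNum = 2 ∧
    ¬ Y1.HasNDisjointCycles 3 := by
  exact ⟨by simp, Y1_sigma2, Y1_alpha, Y1_no_three⟩
end

section
/- Let Q be the graph obtained from the complete bipartite graph K_{4,4} by deleting one vertex v (whose neighbors are w, x, y, z) and adding two new adjacent vertices u, u′ with u adjacent to w and x, and u′ adjacent to y and z, and let Y₂ := K₁ ∨ Q. Then |Y₂| = 10, σ₂(Y₂) = 9, α(Y₂) = 4, and Y₂ does not contain 3 pairwise vertex-disjoint cycles. -/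
/-- The independence number of `G`: the largest size of an independent set of vertices. -/
noncomputable def SimpleGraph.independenceNumber {V : Type*} (G : SimpleGraph V) : ℕ :=
  sSup {n | ∃ s : Finset V, s.card = n ∧ ∀ v ∈ s, ∀ w ∈ s, v ≠ w → ¬ G.Adj v w}

/-- The graph `Y₂ = K₁ ∨ Q`, where `Q` is obtained from `K_{4,4}` with parts
`{0, 1, 2, 3}` and `{4, 5, 6, v}` by deleting the vertex `v` (whose neighbours were
`0, 1, 2, 3`) and adding two new adjacent vertices `7` and `8`, with `7` adjacent to `0, 1`
and `8` adjacent to `2, 3`; the vertex `9` is the apex, joined to all of `Q`. -/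
def Y2 : SimpleGraph (Fin 10) :=
  SimpleGraph.fromRel (fun a b =>
    (a.val ≤ 3 ∧ 4 ≤ b.val ∧ b.val ≤ 6) ∨
    (a.val = 7 ∧ b.val = 8) ∨
    (a.val = 7 ∧ b.val ≤ 1) ∨
    (a.val = 8 ∧ (b.val = 2 ∨ b.val = 3)) ∨
    (a.val = 9))

instance : DecidableRel Y2.Adj := fun a b =>
  decidable_of_iff' _ (SimpleGraph.fromRel_adj _ a b)

lemma Y2_tri : ∀ a b c : Fin 10, Y2.Adj a b → Y2.Adj b c → Y2.Adj c a →
    a = 9 ∨ b = 9 ∨ c = 9 := by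
  decide +kernel

lemma cyc_card {v : Fin 10} (p : Y2.Walk v v) (hp : p.IsCycle) :
    p.length ≤ p.support.toFinset.card := by
  have h1 : p.support.tail.toFinset.card = p.length := by
    rw [List.toFinset_card_of_nodup hp.support_nodup]
    simp
  rw [← h1]
  apply Finset.card_le_card
  intro x hx
  rw [List.mem_toFinset] at hx ⊢
  exact List.mem_of_mem_tail hx

lemma cyc_four {v : Fin 10} (p : Y2.Walk v v) (hp : p.IsCycle) (h9 : 9 ∉ p.support) :
    4 ≤ p.length := by
  by_contra hlt
  have h3 := hp.three_le_length
  have hl : p.length = 3 := by omega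
  match p, hl, h9 with
  | .cons (v := a) h (.cons (v := b) h' (.cons h'' .nil)), _, h9 =>
    have := Y2_tri _ _ _ h h' h''
    simp at h9
    rcases this with h | h | h <;> simp_all

lemma Y2_ind : ∀ s : Finset (Fin 10), (∀ v ∈ s, ∀ w ∈ s, v ≠ w → ¬ Y2.Adj v w) →
    s.card ≤ 4 := by
  decide +kernel

lemma Y2_deg : ∀ x y : Fin 10, x ≠ y → ¬ Y2.Adj x y → 9 ≤ Y2.degree x + Y2.degree y := by
  decide +kernel

/-- The graph `Y₂` has `10` vertices, `σ₂(Y₂) = 9` and `α(Y₂) = 4`, but it does not contain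
`3` pairwise vertex-disjoint cycles. -/
theorem y2_example :
    Fintype.card (Fin 10) = 10 ∧
    Y2.sigma2 = 9 ∧
    Y2.independenceNumber = 4 ∧
    ¬ Y2.HasNDisjointCycles 3 := by
  refine ⟨by simp, ?_, ?_, ?_⟩
  · apply le_antisymm
    · unfold SimpleGraph.sigma2
      refine (iInf_le_of_le 7 <| iInf_le_of_le 2 <| iInf_le_of_le (by decide) <|
        iInf_le_of_le (by decide +kernel) ?_)
      have : Y2.degree 7 + Y2.degree 2 = 9 := by decide +kernel
      rw [this]; rfl
    · unfold SimpleGraph.sigma2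
      refine le_iInf fun x => le_iInf fun y => le_iInf fun h => le_iInf fun h' => ?_
      exact_mod_cast Y2_deg x y h h'
  · apply IsGreatest.csSup_eq
    constructor
    · exact ⟨{0, 1, 2, 3}, by decide, by decide +kernel⟩
    · rintro n ⟨s, rfl, hs⟩
      exact Y2_ind s hs
  · rintro ⟨f, hc, hd⟩
    let S : Fin 3 → Finset (Fin 10) := fun i => (f i).2.support.toFinset
    have hS : ∀ i j, i ≠ j → Disjoint (S i) (S j) := by
      intro i j hij
      rw [Finset.disjoint_left]
      intro x hx hy
      exact hd i j hij x (List.mem_toFinset.1 hx) (List.mem_toFinset.1 hy)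
    have h3 : ∀ i, 3 ≤ (S i).card := fun i =>
      (hc i).three_le_length.trans (cyc_card _ (hc i))
    have h4 : ∀ i, 9 ∉ S i → 4 ≤ (S i).card := fun i hi =>
      (cyc_four _ (hc i) (fun h => hi (List.mem_toFinset.2 h))).trans (cyc_card _ (hc i))
    have hsum : (S 0).card + (S 1).card + (S 2).card ≤ 10 := by
      rw [← Finset.card_union_of_disjoint (hS 0 1 (by decide)),
        ← Finset.card_union_of_disjoint
          (Finset.disjoint_union_left.2 ⟨hS 0 2 (by decide), hS 1 2 (by decide)⟩)]
      exact (Finset.card_le_univ _).trans (by simp)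
    have d01 : 9 ∈ S 0 → 9 ∉ S 1 := fun h => Finset.disjoint_left.1 (hS 0 1 (by decide)) h
    have d02 : 9 ∈ S 0 → 9 ∉ S 2 := fun h => Finset.disjoint_left.1 (hS 0 2 (by decide)) h
    have d12 : 9 ∈ S 1 → 9 ∉ S 2 := fun h => Finset.disjoint_left.1 (hS 1 2 (by decide)) h
    have a0 := h3 0
    have a1 := h3 1
    have a2 := h3 2
    have b0 := h4 0
    have b1 := h4 1
    have b2 := h4 2
    by_cases m0 : 9 ∈ S 0
    · have := b1 (d01 m0)
      have := b2 (d02 m0)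
      omega
    · have := b0 m0
      by_cases m1 : 9 ∈ S 1
      · have := b2 (d12 m1)
        omega
      · have := b1 m1
        omega
end

section
/- Let k ≥ 3 be an integer and let G_k := K̄_{2k−2} ∨ (K̄_{2k−3} + K₃), the join of the empty graph on 2k−2 vertices with the disjoint union of the empty graph on 2k−3 vertices and a triangle K₃. Then |G_k| = 4k−2 ≥ 3k+1, δ(G_k) = 2k−2, α(G_k) = |G_k| − 2k, and G_k does not contain k pairwise vertex-disjoint cycles. -/
/-- The independence number of `G`: the largest size of an independent set of vertices. -/
noncomputable def SimpleGraph.indepNumber {V : Type*} (G : SimpleGraph V) : ℕ :=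
  sSup {n | ∃ s : Finset V, s.card = n ∧ ∀ v ∈ s, ∀ w ∈ s, v ≠ w → ¬ G.Adj v w}

/-- The join `G ∨ H` of two graphs: their disjoint union together with all edges between the
two vertex sets. -/
def SimpleGraph.join {α β : Type*} (G : SimpleGraph α) (H : SimpleGraph β) :
    SimpleGraph (α ⊕ β) where
  Adj x y :=
    Sum.elim (fun a => Sum.elim (fun b => G.Adj a b) (fun _ => True) y)
             (fun a => Sum.elim (fun _ => True) (fun b => H.Adj a b) y) x
  symm := by
    refine ⟨?_⟩
    rintro (a | a) (b | b) h
    · exact G.symm.symm _ _ h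
    · trivial
    · trivial
    · exact H.symm.symm _ _ h
  loopless := by
    refine ⟨?_⟩
    rintro (a | a) h
    · exact G.loopless.irrefl a h
    · exact H.loopless.irrefl a h

instance {α β : Type*} (G : SimpleGraph α) (H : SimpleGraph β) [DecidableRel G.Adj]
    [DecidableRel H.Adj] : DecidableRel (G.join H).Adj := fun x y =>
  match x, y with
  | Sum.inl a, Sum.inl b => inferInstanceAs (Decidable (G.Adj a b))
  | Sum.inl _, Sum.inr _ => inferInstanceAs (Decidable True)
  | Sum.inr _, Sum.inl _ => inferInstanceAs (Decidable True)
  | Sum.inr a, Sum.inr b => inferInstanceAs (Decidable (H.Adj a b))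

/-- The disjoint union `G + H` of two graphs. -/
def SimpleGraph.disjUnion {α β : Type*} (G : SimpleGraph α) (H : SimpleGraph β) :
    SimpleGraph (α ⊕ β) where
  Adj x y :=
    Sum.elim (fun a => Sum.elim (fun b => G.Adj a b) (fun _ => False) y)
             (fun a => Sum.elim (fun _ => False) (fun b => H.Adj a b) y) x
  symm := by
    refine ⟨?_⟩
    rintro (a | a) (b | b) h
    · exact G.symm.symm _ _ h
    · exact h.elim
    · exact h.elim
    · exact H.symm.symm _ _ h
  loopless := by
    refine ⟨?_⟩
    rintro (a | a) h
    · exact G.loopless.irrefl a h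
    · exact H.loopless.irrefl a h

instance {α β : Type*} (G : SimpleGraph α) (H : SimpleGraph β) [DecidableRel G.Adj]
    [DecidableRel H.Adj] : DecidableRel (G.disjUnion H).Adj := fun x y =>
  match x, y with
  | Sum.inl a, Sum.inl b => inferInstanceAs (Decidable (G.Adj a b))
  | Sum.inl _, Sum.inr _ => inferInstanceAs (Decidable False)
  | Sum.inr _, Sum.inl _ => inferInstanceAs (Decidable False)
  | Sum.inr a, Sum.inr b => inferInstanceAs (Decidable (H.Adj a b))

/-- The graph `G_k := K̄_{2k-2} ∨ (K̄_{2k-3} + K₃)`. -/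
def Gk (k : ℕ) : SimpleGraph (Fin (2 * k - 2) ⊕ (Fin (2 * k - 3) ⊕ Fin 3)) :=
  SimpleGraph.join (⊥ : SimpleGraph (Fin (2 * k - 2)))
    (SimpleGraph.disjUnion (⊥ : SimpleGraph (Fin (2 * k - 3))) (⊤ : SimpleGraph (Fin 3)))

instance (k : ℕ) : DecidableRel (Gk k).Adj := by unfold Gk; infer_instance

lemma Gk_ll {k : ℕ} (a b) : ¬ (Gk k).Adj (Sum.inl a) (Sum.inl b) := fun h => h
lemma Gk_lr {k : ℕ} (a b) : (Gk k).Adj (Sum.inl a) (Sum.inr b) := trivial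
lemma Gk_rl {k : ℕ} (a b) : (Gk k).Adj (Sum.inr b) (Sum.inl a) := trivial
lemma Gk_bb {k : ℕ} (a b) : ¬ (Gk k).Adj (Sum.inr (Sum.inl a)) (Sum.inr (Sum.inl b)) := fun h => h
lemma Gk_bt {k : ℕ} (a b) : ¬ (Gk k).Adj (Sum.inr (Sum.inl a)) (Sum.inr (Sum.inr b)) := fun h => h
lemma Gk_tb {k : ℕ} (a b) : ¬ (Gk k).Adj (Sum.inr (Sum.inr a)) (Sum.inr (Sum.inl b)) := fun h => h
lemma Gk_tt {k : ℕ} (a b) :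
    (Gk k).Adj (Sum.inr (Sum.inr a)) (Sum.inr (Sum.inr b)) ↔ a ≠ b := Iff.rfl

lemma Gk_minDegree (k : ℕ) (hk : 3 ≤ k) : (Gk k).minDegree = 2 * k - 2 := by
  classical
  apply le_antisymm
  · refine ((Gk k).minDegree_le_degree (Sum.inr (Sum.inl ⟨0, by omega⟩))).trans ?_
    rw [← SimpleGraph.card_neighborFinset_eq_degree]
    have : (Gk k).neighborFinset (Sum.inr (Sum.inl ⟨0, by omega⟩)) ⊆
        (Finset.univ : Finset (Fin (2 * k - 2))).map Function.Embedding.inl := by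
      intro x hx
      rw [SimpleGraph.mem_neighborFinset] at hx
      rcases x with x | x | x
      · simp
      · exact (Gk_bb _ _ hx).elim
      · exact (Gk_bt _ _ hx).elim
    simpa using Finset.card_le_card this
  · have : Nonempty (Fin (2 * k - 2) ⊕ (Fin (2 * k - 3) ⊕ Fin 3)) := ⟨Sum.inr (Sum.inr 0)⟩
    apply SimpleGraph.le_minDegree_of_forall_le_degree
    intro v
    rw [← SimpleGraph.card_neighborFinset_eq_degree]
    rcases v with v | v
    · have : (Finset.univ : Finset (Fin (2 * k - 3) ⊕ Fin 3)).map Function.Embedding.inr ⊆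
          (Gk k).neighborFinset (Sum.inl v) := by
        intro x hx
        rw [SimpleGraph.mem_neighborFinset]
        rcases x with x | x
        · simp at hx
        · exact Gk_lr _ _
      have := Finset.card_le_card this
      simp only [Finset.card_map, Finset.card_univ, Fintype.card_sum, Fintype.card_fin] at this
      omega
    · have : (Finset.univ : Finset (Fin (2 * k - 2))).map Function.Embedding.inl ⊆
          (Gk k).neighborFinset (Sum.inr v) := by
        intro x hx
        rw [SimpleGraph.mem_neighborFinset]
        rcases x with x | x
        · exact Gk_rl _ _
        · simp at hx
      simpa using Finset.card_le_card this

lemma Gk_indep (k : ℕ) (hk : 3 ≤ k) : (Gk k).indepNumber = 2 * k - 2 := by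
  classical
  apply IsGreatest.csSup_eq
  constructor
  · refine ⟨(Finset.univ : Finset (Fin (2 * k - 2))).map Function.Embedding.inl, by simp, ?_⟩
    rintro (v | v) hv (w | w) hw _
    · exact Gk_ll _ _
    · simp at hw
    · simp at hv
    · simp at hv
  · rintro n ⟨s, rfl, hs⟩
    by_cases h : ∃ x, Sum.inl x ∈ s
    · obtain ⟨x, hx⟩ := h
      have : s ⊆ (Finset.univ : Finset (Fin (2 * k - 2))).map Function.Embedding.inl := by
        rintro (y | y) hy
        · simp
        · exact (hs _ hx _ hy (by simp) (Gk_lr _ _)).elim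
      simpa using Finset.card_le_card this
    · push Not at h
      let f : Fin (2 * k - 2) ⊕ (Fin (2 * k - 3) ⊕ Fin 3) → Option (Fin (2 * k - 3)) :=
        Sum.elim (fun _ => none) (Sum.elim some (fun _ => none))
      have := Finset.card_le_card_of_injOn (s := s) (t := Finset.univ) f (by simp) (by
        rintro (x | x | x) hx (y | y | y) hy hxy
        · exact (h _ hx).elim
        · exact (h _ hx).elim
        · exact (h _ hx).elim
        · exact (h _ hy).elim
        · simp [f] at hxy; rw [hxy]
        · simp [f] at hxy
        · exact (h _ hy).elim
        · simp [f] at hxy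
        · by_contra hne
          exact hs _ hx _ hy hne ((Gk_tt _ _).2 (fun e => hne (by rw [e]))))
      simp at this
      omega

lemma cycle_two_nbrs {V : Type*} {G : SimpleGraph V} {u : V} (p : G.Walk u u) (hp : p.IsCycle)
    (v : V) (hv : v ∈ p.support) :
    ∃ x y, x ≠ y ∧ x ∈ p.support ∧ y ∈ p.support ∧ G.Adj v x ∧ G.Adj v y := by
  have h := hp.ncard_neighborSet_toSubgraph_eq_two hv
  obtain ⟨x, y, hxy, he⟩ := Set.ncard_eq_two.1 h
  have hx : x ∈ p.toSubgraph.neighborSet v := by rw [he]; simp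
  have hy : y ∈ p.toSubgraph.neighborSet v := by rw [he]; simp
  have hx' : p.toSubgraph.Adj v x := hx
  have hy' : p.toSubgraph.Adj v y := hy
  exact ⟨x, y, hxy, p.mem_verts_toSubgraph.1 hx'.snd_mem, p.mem_verts_toSubgraph.1 hy'.snd_mem,
    hx'.adj_sub, hy'.adj_sub⟩

lemma sum_card_le_of_disj {k n : ℕ} (F : Fin k → Finset (Fin n))
    (h : ∀ i j, i ≠ j → ∀ x, x ∈ F i → x ∉ F j) : ∑ i, (F i).card ≤ n := by
  classical
  rw [← Finset.card_biUnion]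
  · simpa using Finset.card_le_univ (Finset.univ.biUnion F)
  · intro i _ j _ hij
    exact Finset.disjoint_left.2 (fun x hx => h i j hij x hx)

/-- Local analysis of a set in which every vertex has two neighbours. -/
lemma Gk_local {k : ℕ} (S : Set (Fin (2 * k - 2) ⊕ (Fin (2 * k - 3) ⊕ Fin 3)))
    (hne : S.Nonempty)
    (H : ∀ v ∈ S, ∃ x y, x ≠ y ∧ x ∈ S ∧ y ∈ S ∧ (Gk k).Adj v x ∧ (Gk k).Adj v y)
    (A : Finset (Fin (2 * k - 2))) (B : Finset (Fin (2 * k - 3))) (T : Finset (Fin 3))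
    (hA : ∀ x, x ∈ A ↔ Sum.inl x ∈ S) (hB : ∀ x, x ∈ B ↔ Sum.inr (Sum.inl x) ∈ S)
    (hT : ∀ x, x ∈ T ↔ Sum.inr (Sum.inr x) ∈ S) :
    (2 ≤ A.card ∨ (1 ≤ A.card ∧ 2 ≤ T.card) ∨ T.card = 3) ∧ (T.card = 0 → 2 ≤ B.card) := by
  classical
  -- a vertex of the empty part on the right forces two vertices on the left
  have hBA : ∀ b ∈ B, 2 ≤ A.card := by
    intro b hb
    obtain ⟨x, y, hxy, hx, hy, ax, ay⟩ := H _ ((hB b).1 hb)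
    rcases x with x | x | x
    · rcases y with y | y | y
      · exact Finset.one_lt_card.2 ⟨x, (hA x).2 hx, y, (hA y).2 hy, fun e => hxy (by rw [e])⟩
      · exact (Gk_bb _ _ ay).elim
      · exact (Gk_bt _ _ ay).elim
    · exact (Gk_bb _ _ ax).elim
    · exact (Gk_bt _ _ ax).elim
  -- a vertex on the left
  have hAN : ∀ a ∈ A, (∃ b, b ∈ B) ∨ 2 ≤ T.card := by
    intro a ha
    obtain ⟨x, y, hxy, hx, hy, ax, ay⟩ := H _ ((hA a).1 ha)
    rcases x with x | x | x
    · exact (Gk_ll _ _ ax).elim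
    · exact Or.inl ⟨x, (hB x).2 hx⟩
    · rcases y with y | y | y
      · exact (Gk_ll _ _ ay).elim
      · exact Or.inl ⟨y, (hB y).2 hy⟩
      · exact Or.inr (Finset.one_lt_card.2
          ⟨x, (hT x).2 hx, y, (hT y).2 hy, fun e => hxy (by rw [e])⟩)
  constructor
  · by_cases hb : ∃ b, b ∈ B
    · obtain ⟨b, hb⟩ := hb
      exact Or.inl (hBA b hb)
    by_cases ha : ∃ a, a ∈ A
    · obtain ⟨a, ha⟩ := ha
      exact Or.inr (Or.inl ⟨Finset.card_pos.2 ⟨a, ha⟩, (hAN a ha).resolve_left hb⟩)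
    · right; right
      obtain ⟨v, hv⟩ := hne
      rcases v with v | v | v
      · exact (ha ⟨v, (hA v).2 hv⟩).elim
      · exact (hb ⟨v, (hB v).2 hv⟩).elim
      obtain ⟨x, y, hxy, hx, hy, ax, ay⟩ := H _ hv
      rcases x with x | x | x
      · exact (ha ⟨x, (hA x).2 hx⟩).elim
      · exact (hb ⟨x, (hB x).2 hx⟩).elim
      rcases y with y | y | y
      · exact (ha ⟨y, (hA y).2 hy⟩).elim
      · exact (hb ⟨y, (hB y).2 hy⟩).elim
      have h3 : 2 < T.card := Finset.two_lt_card.2 ⟨v, (hT v).2 hv, x, (hT x).2 hx, y,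
        (hT y).2 hy, (Gk_tt _ _).1 ax, (Gk_tt _ _).1 ay, fun e => hxy (by rw [e])⟩
      have := Finset.card_le_univ T
      simp at this
      omega
  · intro hT0
    have hTe : ∀ t, Sum.inr (Sum.inr t) ∉ S := by
      intro t ht
      have := Finset.card_pos.2 ⟨t, (hT t).2 ht⟩
      omega
    have key : ∀ a ∈ A, 2 ≤ B.card := by
      intro a ha
      obtain ⟨x, y, hxy, hx, hy, ax, ay⟩ := H _ ((hA a).1 ha)
      rcases x with x | x | x
      · exact (Gk_ll _ _ ax).elim
      · rcases y with y | y | y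
        · exact (Gk_ll _ _ ay).elim
        · exact Finset.one_lt_card.2 ⟨x, (hB x).2 hx, y, (hB y).2 hy, fun e => hxy (by rw [e])⟩
        · exact (hTe _ hy).elim
      · exact (hTe _ hx).elim
    obtain ⟨v, hv⟩ := hne
    rcases v with v | v | v
    · exact key v ((hA v).2 hv)
    · have h2 := hBA v ((hB v).2 hv)
      obtain ⟨a, ha⟩ := Finset.card_pos.1 (show 0 < A.card by omega)
      exact key a ha
    · exact (hTe _ hv).elim

lemma Gk_noCycles (k : ℕ) (hk : 3 ≤ k) : ¬ (Gk k).HasNDisjointCycles k := by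
  classical
  rintro ⟨f, hc, hd⟩
  let A : Fin k → Finset (Fin (2 * k - 2)) := fun i =>
    Finset.univ.filter (fun x => Sum.inl x ∈ (f i).2.support)
  let B : Fin k → Finset (Fin (2 * k - 3)) := fun i =>
    Finset.univ.filter (fun x => Sum.inr (Sum.inl x) ∈ (f i).2.support)
  let T : Fin k → Finset (Fin 3) := fun i =>
    Finset.univ.filter (fun x => Sum.inr (Sum.inr x) ∈ (f i).2.support)
  have hAs : ∑ i, (A i).card ≤ 2 * k - 2 := sum_card_le_of_disj A (fun i j hij x hx hy =>
    hd i j hij _ (Finset.mem_filter.1 hx).2 (Finset.mem_filter.1 hy).2)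
  have hBs : ∑ i, (B i).card ≤ 2 * k - 3 := sum_card_le_of_disj B (fun i j hij x hx hy =>
    hd i j hij _ (Finset.mem_filter.1 hx).2 (Finset.mem_filter.1 hy).2)
  have hTs : ∑ i, (T i).card ≤ 3 := sum_card_le_of_disj T (fun i j hij x hx hy =>
    hd i j hij _ (Finset.mem_filter.1 hx).2 (Finset.mem_filter.1 hy).2)
  have hloc : ∀ i, (2 ≤ (A i).card ∨ (1 ≤ (A i).card ∧ 2 ≤ (T i).card) ∨ (T i).card = 3) ∧
      ((T i).card = 0 → 2 ≤ (B i).card) := fun i =>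
    Gk_local {v | v ∈ (f i).2.support} ⟨_, (f i).2.start_mem_support⟩
      (fun v hv => cycle_two_nbrs _ (hc i) v hv) (A i) (B i) (T i)
      (by simp [A]) (by simp [B]) (by simp [T])
  by_cases h3 : ∃ i, (T i).card = 3
  · obtain ⟨i, hi⟩ := h3
    have e1 := Finset.add_sum_erase Finset.univ (fun i => (T i).card) (Finset.mem_univ i)
    have e2 := Finset.add_sum_erase Finset.univ (fun i => (B i).card) (Finset.mem_univ i)
    have e3 : ∑ j ∈ Finset.univ.erase i, (T j).card = 0 := by omega
    have e4 : ∑ j ∈ Finset.univ.erase i, 2 ≤ ∑ j ∈ Finset.univ.erase i, (B j).card :=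
      Finset.sum_le_sum (fun j hj => (hloc j).2 (Finset.sum_eq_zero_iff.1 e3 j hj))
    simp [Finset.card_erase_of_mem] at e4
    omega
  · push Not at h3
    have e1 : ∑ i : Fin k, 2 ≤ ∑ i, ((A i).card + (T i).card / 2) :=
      Finset.sum_le_sum (fun i _ => by have := (hloc i).1; have := h3 i; omega)
    have e2 : ∑ i, (T i).card / 2 ≤ (∑ i, (T i).card) / 2 := by
      rw [Nat.le_div_iff_mul_le (by norm_num), Finset.sum_mul]
      exact Finset.sum_le_sum (fun i _ => Nat.div_mul_le_self _ _)
    rw [Finset.sum_add_distrib] at e1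
    simp at e1
    omega

/-- For `k ≥ 3`, the graph `G_k = K̄_{2k-2} ∨ (K̄_{2k-3} + K₃)` has `4k - 2 ≥ 3k + 1` vertices,
minimum degree `2k - 2` and independence number `|G_k| - 2k`, but it does not contain `k`
pairwise disjoint cycles. -/
theorem extremal_example_sigma (k : ℕ) (hk : 3 ≤ k) :
    Fintype.card (Fin (2 * k - 2) ⊕ (Fin (2 * k - 3) ⊕ Fin 3)) = 4 * k - 2 ∧
    3 * k + 1 ≤ 4 * k - 2 ∧
    (Gk k).minDegree = 2 * k - 2 ∧
    (Gk k).indepNumber = Fintype.card (Fin (2 * k - 2) ⊕ (Fin (2 * k - 3) ⊕ Fin 3)) - 2 * k ∧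
    ¬ (Gk k).HasNDisjointCycles k := by
  refine ⟨?_, by omega, Gk_minDegree k hk, ?_, Gk_noCycles k hk⟩
  · simp only [Fintype.card_sum, Fintype.card_fin]
    omega
  · rw [Gk_indep k hk]
    simp only [Fintype.card_sum, Fintype.card_fin]
    omega
end

section
/- Let G := C₅[K̄₃] be the blow-up of the 5-cycle by independent sets of size 3: the vertex set is V(C₅) × {1,2,3}, and (x,a) is adjacent to (y,b) if and only if xy is an edge of C₅. Then |G| = 15, δ(G) = 6, α(G) = 6, G has girth 4, and G does not contain 4 pairwise vertex-disjoint cycles. -/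
/-- The blow-up `C₅[K̄₃]` of the `5`-cycle by independent sets of size `3`:
`(x, a)` is adjacent to `(y, b)` iff `x` and `y` are adjacent in `C₅`. -/
def C5BlowUp : SimpleGraph (Fin 5 × Fin 3) where
  Adj p q := (SimpleGraph.cycleGraph 5).Adj p.1 q.1
  symm := ⟨fun _ _ h => (SimpleGraph.cycleGraph 5).symm.symm _ _ h⟩
  loopless := ⟨fun p h => (SimpleGraph.cycleGraph 5).loopless.irrefl p.1 h⟩

instance : DecidableRel C5BlowUp.Adj :=
  fun p q => inferInstanceAs (Decidable ((SimpleGraph.cycleGraph 5).Adj p.1 q.1))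

theorem C5_cycle_len {u : Fin 5 × Fin 3} (p : C5BlowUp.Walk u u) (hp : p.IsCycle) :
    4 ≤ p.length := by
  have h3 := hp.three_le_length
  by_contra hlt
  have hl : p.length = 3 := by omega
  have key : ∀ x y z : Fin 5, (SimpleGraph.cycleGraph 5).Adj x y →
      (SimpleGraph.cycleGraph 5).Adj y z → ¬ (SimpleGraph.cycleGraph 5).Adj z x := by decide
  have e0 := p.adj_getVert_succ (i := 0) (by omega)
  have e1 := p.adj_getVert_succ (i := 1) (by omega)
  have e2 := p.adj_getVert_succ (i := 2) (by omega)
  have ha : p.getVert 0 = u := p.getVert_zero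
  have hb : p.getVert (2 + 1) = u := by
    have := p.getVert_length
    rwa [hl] at this
  rw [hb] at e2
  rw [ha] at e0
  exact key _ _ _ e0 e1 e2

theorem C5_indep : C5BlowUp.independenceNum = 6 := by
  have key : ∀ t : Finset (Fin 5),
      (∀ x ∈ t, ∀ y ∈ t, ¬ (SimpleGraph.cycleGraph 5).Adj x y) → t.card ≤ 2 := by decide
  apply IsGreatest.csSup_eq
  constructor
  · exact ⟨({0, 2} : Finset (Fin 5)) ×ˢ Finset.univ, by decide, by decide⟩
  · rintro n ⟨s, rfl, hs⟩
    have h1 : (s.image Prod.fst).card ≤ 2 := by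
      apply key
      intro x hx y hy hxy
      obtain ⟨v, hv, rfl⟩ := Finset.mem_image.1 hx
      obtain ⟨w, hw, rfl⟩ := Finset.mem_image.1 hy
      exact hs v hv w hw (fun h => C5BlowUp.ne_of_adj (a := v) (b := w) hxy h) hxy
    have h2 : s ⊆ s.image Prod.fst ×ˢ (Finset.univ : Finset (Fin 3)) := by
      intro v hv
      exact Finset.mem_product.2 ⟨Finset.mem_image_of_mem _ hv, Finset.mem_univ _⟩
    have h3 := Finset.card_le_card h2
    rw [Finset.card_product, Finset.card_univ, Fintype.card_fin] at h3
    omega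

theorem C5_girth : C5BlowUp.girth = 4 := by
  have a1 : C5BlowUp.Adj (0, 0) (1, 0) := by decide
  have a2 : C5BlowUp.Adj (1, 0) (0, 1) := by decide
  have a3 : C5BlowUp.Adj (0, 1) (1, 1) := by decide
  have a4 : C5BlowUp.Adj (1, 1) (0, 0) := by decide
  have hc : (SimpleGraph.Walk.cons a1 (.cons a2 (.cons a3 (.cons a4 .nil)))).IsCycle := by
    rw [SimpleGraph.Walk.cons_isCycle_iff]
    constructor
    · simp [SimpleGraph.Walk.isPath_def]
    · simp
  have he : C5BlowUp.egirth = 4 := by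
    apply le_antisymm
    · exact SimpleGraph.egirth_le_length hc
    · rw [SimpleGraph.le_egirth]
      intro a w hw
      exact_mod_cast C5_cycle_len w hw
  rw [SimpleGraph.girth, he]
  rfl

theorem C5_disj : ¬ C5BlowUp.HasNDisjointCycles 4 := by
  rintro ⟨f, hf, hd⟩
  let S : Fin 4 → Finset (Fin 5 × Fin 3) := fun i => (f i).2.support.tail.toFinset
  have hS : ∀ i, 4 ≤ (S i).card := by
    intro i
    have h := C5_cycle_len _ (hf i)
    have h2 : (S i).card = (f i).2.support.tail.length :=
      List.toFinset_card_of_nodup (hf i).support_nodup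
    rw [h2, List.length_tail, SimpleGraph.Walk.length_support]
    omega
  have hU : (Finset.univ.biUnion S).card = ∑ i, (S i).card := by
    apply Finset.card_biUnion
    intro i _ j _ hij
    rw [Function.onFun, Finset.disjoint_left]
    intro v hv hv'
    exact hd i j hij v (List.mem_of_mem_tail (List.mem_toFinset.1 hv))
      (List.mem_of_mem_tail (List.mem_toFinset.1 hv'))
  have h16 : ∑ _i : Fin 4, 4 ≤ ∑ i, (S i).card := Finset.sum_le_sum fun i _ => hS i
  have h15 := Finset.card_le_univ (Finset.univ.biUnion S)
  simp at h16 h15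
  omega

/-- The blow-up `G = C₅[K̄₃]` has `15` vertices, minimum degree `6`, independence number `6`
and girth `4`, but it does not contain `4` pairwise vertex-disjoint cycles. -/
theorem c5_blowup_example :
    Fintype.card (Fin 5 × Fin 3) = 15 ∧
    C5BlowUp.minDegree = 6 ∧
    C5BlowUp.independenceNum = 6 ∧
    C5BlowUp.girth = 4 ∧
    ¬ C5BlowUp.HasNDisjointCycles 4 := by
  refine ⟨by simp, ?_, C5_indep, C5_girth, C5_disj⟩
  have h : C5BlowUp.IsRegularOfDegree 6 := by
    unfold SimpleGraph.IsRegularOfDegree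
    decide
  exact h.minDegree_eq
end
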